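/- Let n ≥ 1 and let θ be an n×n complex matrix. Then 2^{−n²} · ∑_{s ∈ {0,1}^{n×n}} perm(M_s(θ)) = ∑_{σ₁,σ₂ ∈ S_n} (∏_{i=1}^n θ_{i,σ₁(i)} θ_{i,σ₂(i)}) · 2^{−c(σ₁σ₂⁻¹)}, where c(σ) denotes the number of cycles of length at least 2 in the cycle decomposition of σ. (Both sides equal the square of the degree-2 Bethe permanent of θ.) -/

import Mathlib

open scoped BigOperators

/-- The permanent of a square complex matrix. -/
noncomputable def cperm {ι : Type*} [DecidableEq ι] [Fintype ι]
    (M : Matrix ι ι ℂ) : ℂ :=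
  ∑ σ : Equiv.Perm ι, ∏ i, M i (σ i)

/-- The weighted biadjacency matrix `M_s(θ)` of the double cover of `K_{n,n}`
specified by `s : {1,…,n}² → {0,1}` (here `{0,1}` is modelled by `Bool`, and
addition mod 2 by `xor`). -/
def Mcover {n : ℕ} (θ : Matrix (Fin n) (Fin n) ℂ) (s : Fin n → Fin n → Bool) :
    Matrix (Fin n × Bool) (Fin n × Bool) ℂ :=
  Matrix.of fun p q => if q.2 = xor p.2 (s p.1 q.1) then θ p.1 q.1 else 0

namespace DoubleCover

open Equiv Finset

section Counting

variable {ι : Type*} [Fintype ι] [DecidableEq ι]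

/-- Two-colourings invariant under `τ` amount to one colour per nontrivial cycle and one colour
per fixed point. -/
theorem card_invariant_coloring (τ : Perm ι) :
    #{ε : ι → Bool | ∀ i, ε (τ i) = ε i} =
      2 ^ τ.cycleType.card * 2 ^ #{i | τ i = i} := by
  classical
  let Φ : (τ.cycleFactorsFinset → Bool) × ({i // τ i = i} → Bool) →
      {ε : ι → Bool // ∀ i, ε (τ i) = ε i} := fun p =>
    ⟨fun i => if h : τ i = i then p.2 ⟨i, h⟩ else
      p.1 ⟨τ.cycleOf i, Perm.cycleOf_mem_cycleFactorsFinset_iff.2 (Perm.mem_support.2 h)⟩, by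
      intro i
      by_cases h : τ i = i
      · simp [h]
      · have h' : τ (τ i) ≠ τ i := fun e => h (τ.injective e)
        simp [h]⟩
  have hΦ : Function.Bijective Φ := by
    constructor
    · rintro ⟨a, b⟩ ⟨a', b'⟩ h
      have hv : ∀ i, (Φ (a, b)).1 i = (Φ (a', b')).1 i := fun i => by rw [h]
      ext c
      · obtain ⟨i, hi⟩ := (Perm.mem_cycleFactorsFinset_iff.1 c.2).1.nonempty_support
        have hc := Perm.cycle_is_cycleOf hi c.2
        have hn : τ i ≠ i := Perm.mem_support.1 (Perm.mem_cycleFactorsFinset_support_le c.2 hi)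
        have hcc : c = ⟨τ.cycleOf i, Perm.cycleOf_mem_cycleFactorsFinset_iff.2
            (Perm.mem_support.2 hn)⟩ := Subtype.ext hc
        have := hv i
        simp only [Φ, hn, dite_false] at this
        rw [hcc]
        exact this
      · have := hv c.1
        simp only [Φ, c.2, dite_true] at this
        exact this
    · rintro ⟨ε, hε⟩
      have hsame : ∀ i j, τ.SameCycle i j → ε i = ε j := by
        intro i j hij
        obtain ⟨k, -, -, rfl⟩ := hij.exists_pow_eq τ
        clear hij
        induction k with
        | zero => rfl
        | succ k ih => rw [pow_succ', Perm.mul_apply, hε, ih]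
      have hne : ∀ c : τ.cycleFactorsFinset, ∃ i, i ∈ c.1.support := fun c =>
        (Perm.mem_cycleFactorsFinset_iff.1 c.2).1.nonempty_support
      choose r hr using hne
      refine ⟨(fun c => ε (r c), fun i => ε i.1), Subtype.ext (funext fun i => ?_)⟩
      by_cases h : τ i = i
      · simp [Φ, h]
      · simp only [Φ, h, dite_false]
        exact (hsame _ _ (Perm.mem_support_cycleOf_iff.1 (hr ⟨τ.cycleOf i, _⟩)).1).symm
  have := Fintype.card_of_bijective hΦ
  rw [← Fintype.card_subtype, ← this]
  simp [Perm.cycleType_def, Fintype.card_subtype]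

/-- The number of functions `ι → Bool` with (consistently) prescribed values at `j₀` and `j₁`. -/
theorem card_prescribed_row (j₀ j₁ : ι) (b₀ b₁ : Bool) (h : j₀ = j₁ → b₀ = b₁) :
    (#{f : ι → Bool | f j₀ = b₀ ∧ f j₁ = b₁} : ℂ) =
      2 ^ Fintype.card ι * (2⁻¹ * if j₀ = j₁ then 1 else 2⁻¹) := by
  have hset : ({f : ι → Bool | f j₀ = b₀ ∧ f j₁ = b₁} : Finset _) =
      Fintype.piFinset fun j => ({b | (j = j₀ → b = b₀) ∧ (j = j₁ → b = b₁)} : Finset Bool) := by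
    ext f
    simp only [mem_filter, mem_univ, true_and, Fintype.mem_piFinset]
    grind
  have hcard : ∀ j, ((#{b : Bool | (j = j₀ → b = b₀) ∧ (j = j₁ → b = b₁)} : ℕ) : ℂ) =
      2 * ((if j = j₀ then 2⁻¹ else 1) * if j = j₁ then (if j₀ = j₁ then 1 else 2⁻¹) else 1) := by
    intro j
    by_cases h₀ : j = j₀ <;> by_cases h₁ : j = j₁
    · have e : j₀ = j₁ := h₀.symm.trans h₁
      simp [h₁, e, h e, Finset.filter_eq']
    · have e : j₀ ≠ j₁ := fun e => h₁ (h₀.trans e)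
      simp [h₀, e, Finset.filter_eq']
    · have e : j₁ ≠ j₀ := fun e => h₀ (h₁.trans e)
      simp [h₁, e, e.symm, Finset.filter_eq']
    · simp [h₀, h₁]
  rw [hset, Fintype.card_piFinset, Nat.cast_prod, prod_congr rfl fun j _ => hcard j]
  simp only [prod_mul_distrib, prod_const, card_univ, prod_ite_eq', mem_univ, if_true]

/-- The number of double covers in which the lifted edges used by `π` all exist. -/
theorem card_compatible_cover (π : Perm (ι × Bool)) :
    (#{s : ι → ι → Bool | ∀ p, (π p).2 = xor p.2 (s p.1 (π p).1)} : ℂ) =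
      2 ^ Fintype.card ι ^ 2 * ((2 ^ Fintype.card ι)⁻¹ *
        ∏ i, if (π (i, false)).1 = (π (i, true)).1 then 1 else 2⁻¹) := by
  have hset : ({s : ι → ι → Bool | ∀ p, (π p).2 = xor p.2 (s p.1 (π p).1)} : Finset _) =
      Fintype.piFinset fun i => ({f | f (π (i, false)).1 = (π (i, false)).2 ∧
        f (π (i, true)).1 = !(π (i, true)).2} : Finset (ι → Bool)) := by
    ext s
    simp only [mem_filter, mem_univ, true_and, Fintype.mem_piFinset, Prod.forall, Bool.forall_bool,
      Bool.false_xor, Bool.true_xor]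
    refine forall_congr' fun i => and_congr eq_comm ?_
    rw [eq_comm, Bool.not_eq_eq_eq_not]
  have hrow : ∀ i, (#{f : ι → Bool | f (π (i, false)).1 = (π (i, false)).2 ∧
        f (π (i, true)).1 = !(π (i, true)).2} : ℂ) = _ := fun i =>
    card_prescribed_row _ _ _ _ fun h => by
      by_contra hne
      have : π (i, false) = π (i, true) := Prod.ext h (by simpa using hne)
      simpa using π.injective this
  rw [hset, Fintype.card_piFinset, Nat.cast_prod, prod_congr rfl fun i _ => hrow i]
  simp only [prod_mul_distrib, prod_const, card_univ, ← pow_mul, inv_pow, sq]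

end Counting

section Splitting

variable {ι : Type*}

/-- Exchange the two sheets above each row `i` with `ε i = true`. -/
def sheetSwap (ε : ι → Bool) : Perm (ι × Bool) where
  toFun p := (p.1, xor p.2 (ε p.1))
  invFun p := (p.1, xor p.2 (ε p.1))
  left_inv p := by simp
  right_inv p := by simp

/-- Both sheets of `π` project to permutations of `ι`. -/
def IsSplit (π : Perm (ι × Bool)) : Prop :=
  ∀ m, Function.Bijective fun i => (π (i, m)).1

theorem sheetSwap_mul (δ ε : ι → Bool) :
    sheetSwap δ * sheetSwap ε = sheetSwap fun i => xor (δ i) (ε i) := by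
  ext p <;> simp [sheetSwap, Bool.xor_comm, Bool.xor_left_comm]

variable [Fintype ι]

/-- The split permutation with sheets `σ₁`, `σ₂` and column exchanges `δ`. -/
noncomputable def liftPair (σ₁ σ₂ : Perm ι) (δ : ι → Bool) : Perm (ι × Bool) :=
  Equiv.ofBijective (fun p => (cond p.2 (σ₂ p.1) (σ₁ p.1),
      xor p.2 (δ (cond p.2 (σ₂ p.1) (σ₁ p.1))))) <| by
    refine Finite.injective_iff_bijective.1 ?_
    rintro ⟨i, m⟩ ⟨i', m'⟩ h
    obtain ⟨h₁, h₂⟩ := Prod.ext_iff.1 h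
    simp only at h₁ h₂
    rw [h₁, Bool.xor_left_inj] at h₂
    subst h₂
    cases m <;> simpa using h₁

theorem liftPair_apply (σ₁ σ₂ : Perm ι) (δ : ι → Bool) (i : ι) (m : Bool) :
    liftPair σ₁ σ₂ δ (i, m) =
      (cond m (σ₂ i) (σ₁ i), xor m (δ (cond m (σ₂ i) (σ₁ i)))) := rfl

theorem isSplit_liftPair (σ₁ σ₂ : Perm ι) (δ : ι → Bool) : IsSplit (liftPair σ₁ σ₂ δ) := by
  rintro (_ | _)
  exacts [σ₁.bijective, σ₂.bijective]

theorem isSplit_liftPair_mul_sheetSwap (σ₁ σ₂ : Perm ι) (δ ε : ι → Bool) :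
    IsSplit (liftPair σ₁ σ₂ δ * sheetSwap ε) ↔ ∀ i, ε ((σ₂⁻¹ * σ₁) i) = ε i := by
  set τ := σ₂⁻¹ * σ₁ with hτ
  have hσ : ∀ i, σ₁ i = σ₂ (τ i) := fun i => by simp [hτ]
  have hval : ∀ m i, ((liftPair σ₁ σ₂ δ * sheetSwap ε) (i, m)).1 =
      σ₂ (cond (xor m (ε i)) i (τ i)) := fun m i => by
    rw [Perm.mul_apply]
    change cond (xor m (ε i)) (σ₂ i) (σ₁ i) = _
    rw [hσ]
    cases xor m (ε i) <;> rfl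
  constructor
  · intro h i
    by_contra hne
    have hinj := (h (ε i)).1
    have := @hinj i (τ i) (by
      have hx : xor (ε i) (ε (τ i)) = true := by
        cases h₁ : ε i <;> cases h₂ : ε (τ i) <;> simp_all
      simp only [hval, hx, Bool.xor_self, cond_true, cond_false])
    exact hne (by rw [← this])
  · intro h m
    refine Finite.injective_iff_bijective.1 fun i i' hii => ?_
    simp only [hval, EmbeddingLike.apply_eq_iff_eq] at hii
    cases h₁ : xor m (ε i) <;> cases h₂ : xor m (ε i') <;>
      simp only [h₁, h₂, cond_true, cond_false] at hii
    · exact τ.injective hii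
    · rw [← hii, h, h₁] at h₂
      exact absurd h₂ (by decide)
    · rw [hii, h, h₂] at h₁
      exact absurd h₁ (by decide)
    · exact hii

variable [DecidableEq ι]

/-- A `2`-regular bipartite multigraph decomposes into two perfect matchings. -/
theorem exists_isSplit_mul_sheetSwap (π : Perm (ι × Bool)) :
    ∃ ε, IsSplit (π * sheetSwap ε) := by
  obtain ⟨f, hf, hft⟩ := (all_card_le_biUnion_card_iff_exists_injective
    fun i => (univ : Finset Bool).image fun m => (π (i, m)).1).1 fun S => by
      have h : #(S ×ˢ (univ : Finset Bool)) ≤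
          #((S.biUnion fun i => univ.image fun m => (π (i, m)).1) ×ˢ (univ : Finset Bool)) := by
        refine card_le_card_of_injOn π (fun p hp => ?_) π.injective.injOn
        simp only [coe_product, Set.mem_prod, mem_coe, mem_univ, and_true, mem_biUnion,
          mem_image, true_and] at hp ⊢
        exact ⟨p.1, hp, p.2, rfl⟩
      simpa [card_product] using h
  simp only [mem_image, mem_univ, true_and] at hft
  choose ε hε using hft
  have hb : Function.Bijective f := Finite.injective_iff_bijective.1 hf
  refine ⟨ε, Bool.forall_bool.2 ⟨?_, ?_⟩⟩
  · simpa [sheetSwap, hε] using hb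
  · refine Finite.surjective_iff_bijective.1 fun j => ?_
    by_contra! hj
    have key : ∀ m, π.symm (j, m) = ((π.symm (j, m)).1, ε (π.symm (j, m)).1) := fun m => by
      refine Prod.ext rfl ?_
      by_contra hne
      have h2 : (π.symm (j, m)).2 = !ε (π.symm (j, m)).1 := Bool.eq_not.2 hne
      apply hj (π.symm (j, m)).1
      simp only [sheetSwap, Perm.mul_apply, coe_fn_mk, Bool.true_xor, ← h2, Prod.mk.eta,
        apply_symm_apply]
    have hfj : ∀ m, f (π.symm (j, m)).1 = j := fun m => by
      rw [← hε, ← key, apply_symm_apply]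
    have hrow := hf ((hfj false).trans (hfj true).symm)
    have : π.symm (j, false) = π.symm (j, true) := by
      rw [key false, key true, hrow]
    simpa using π.symm.injective this

open scoped Classical in
/-- The number of ways to make `π` split by sheet exchanges. -/
noncomputable def splitCount (π : Perm (ι × Bool)) : ℕ :=
  #{ε | IsSplit (π * sheetSwap ε)}

theorem splitCount_ne_zero (π : Perm (ι × Bool)) : splitCount π ≠ 0 := by
  classical
  obtain ⟨ε, hε⟩ := exists_isSplit_mul_sheetSwap π
  exact card_ne_zero_of_mem (mem_filter.2 ⟨mem_univ ε, hε⟩)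

theorem splitCount_mul_sheetSwap (π : Perm (ι × Bool)) (δ : ι → Bool) :
    splitCount (π * sheetSwap δ) = splitCount π := by
  classical
  have hinv : Function.Involutive fun (ε : ι → Bool) i => xor (δ i) (ε i) := fun ε => by
    funext i; simp
  refine card_equiv hinv.toPerm fun ε => ?_
  simp [mul_assoc, sheetSwap_mul]

open scoped Classical in
/-- Averaging over sheet exchanges concentrates an exchange-invariant sum on split
permutations. -/
theorem sum_eq_sum_isSplit (F : Perm (ι × Bool) → ℂ)
    (hF : ∀ π ε, F (π * sheetSwap ε) = F π) :
    ∑ π, F π = 2 ^ Fintype.card ι * ∑ π with IsSplit π, F π / splitCount π := by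
  calc ∑ π, F π
      = ∑ π, ∑ ε : ι → Bool, if IsSplit (π * sheetSwap ε) then
          F (π * sheetSwap ε) / splitCount (π * sheetSwap ε) else 0 := by
        refine sum_congr rfl fun π _ => ?_
        simp only [hF, splitCount_mul_sheetSwap]
        rw [← sum_filter, sum_const, nsmul_eq_mul]
        change _ = (splitCount π : ℂ) * _
        rw [mul_div_cancel₀]
        exact Nat.cast_ne_zero.2 (splitCount_ne_zero π)
    _ = ∑ ε : ι → Bool, ∑ π, if IsSplit π then F π / splitCount π else 0 := by
        rw [sum_comm]
        exact sum_congr rfl fun ε _ => Equiv.sum_comp (Equiv.mulRight (sheetSwap ε))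
          fun π => if IsSplit π then F π / splitCount π else 0
    _ = _ := by simp [sum_filter]

open scoped Classical in
theorem sum_isSplit (H : Perm (ι × Bool) → ℂ) :
    ∑ π with IsSplit π, H π = ∑ σ₁, ∑ σ₂, ∑ δ, H (liftPair σ₁ σ₂ δ) := by
  rw [← Finset.sum_product', ← Finset.sum_product']
  symm
  refine sum_bij (fun p _ => liftPair p.1.1 p.1.2 p.2) (fun p _ => by simp [isSplit_liftPair])
    ?_ ?_ (fun _ _ => rfl)
  · rintro ⟨⟨σ₁, σ₂⟩, δ⟩ - ⟨⟨σ₁', σ₂'⟩, δ'⟩ - h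
    have hp : ∀ i m, liftPair σ₁ σ₂ δ (i, m) = liftPair σ₁' σ₂' δ' (i, m) := fun i m => by
      rw [show liftPair σ₁ σ₂ δ = liftPair σ₁' σ₂' δ' from h]
    have h₁ : σ₁ = σ₁' := Equiv.ext fun i => congrArg Prod.fst (hp i false)
    have h₂ : σ₂ = σ₂' := Equiv.ext fun i => congrArg Prod.fst (hp i true)
    subst h₁ h₂
    have h₃ : δ = δ' := funext fun j => by
      have := congrArg Prod.snd (hp (σ₁.symm j) false)
      simpa [liftPair_apply] using this
    rw [h₃]
  · intro π hπ
    rw [mem_filter] at hπ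
    let σ (m : Bool) : Perm ι := Equiv.ofBijective _ (hπ.2 m)
    have hσ : ∀ m i, (π (i, m)).1 = σ m i := fun _ _ => rfl
    let δ (j : ι) : Bool := (π ((σ false).symm j, false)).2
    refine ⟨((σ false, σ true), δ), mem_univ _, Equiv.ext ?_⟩
    rintro ⟨i, _ | _⟩
    · exact Prod.ext rfl (by simp [liftPair_apply, δ])
    · refine Prod.ext rfl ?_
      simp only [liftPair_apply, cond_true, Bool.true_xor, δ]
      by_contra hne
      have : π ((σ false).symm (σ true i), false) = π (i, true) :=
        Prod.ext (by rw [hσ, hσ, apply_symm_apply]) (by simpa using hne)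
      simpa using π.injective this

theorem splitCount_liftPair (σ₁ σ₂ : Perm ι) (δ : ι → Bool) :
    splitCount (liftPair σ₁ σ₂ δ) =
      2 ^ (σ₁ * σ₂⁻¹).cycleType.card * 2 ^ #{i | σ₁ i = σ₂ i} := by
  have hconj : σ₁ * σ₂⁻¹ = σ₂ * (σ₂⁻¹ * σ₁) * σ₂⁻¹ := by group
  rw [hconj, Perm.cycleType_conj]
  have hfix : ∀ i, (σ₂⁻¹ * σ₁) i = i ↔ σ₁ i = σ₂ i := fun i => by
    rw [Perm.mul_apply, Perm.inv_eq_iff_eq]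
  have hcard := card_invariant_coloring (σ₂⁻¹ * σ₁)
  rw [filter_congr fun i _ => hfix i] at hcard
  rw [← hcard, splitCount]
  refine congrArg card (ext fun ε => ?_)
  simp only [mem_filter, isSplit_liftPair_mul_sheetSwap]

/-- The contribution of the shadow of `π` in the base graph to the averaged permanent. -/
noncomputable def shadowWeight (θ : Matrix ι ι ℂ) (π : Perm (ι × Bool)) : ℂ :=
  ∏ i, (θ i (π (i, false)).1 * θ i (π (i, true)).1) *
    if (π (i, false)).1 = (π (i, true)).1 then 1 else 2⁻¹

theorem shadowWeight_mul_sheetSwap (θ : Matrix ι ι ℂ) (π : Perm (ι × Bool)) (ε : ι → Bool) :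
    shadowWeight θ (π * sheetSwap ε) = shadowWeight θ π := by
  refine prod_congr rfl fun i _ => ?_
  cases h : ε i
  · simp [sheetSwap, h]
  · simp [sheetSwap, h, mul_comm (θ i (π (i, true)).1), eq_comm (a := (π (i, true)).1)]

theorem shadowWeight_liftPair_div (θ : Matrix ι ι ℂ) (σ₁ σ₂ : Perm ι) (δ : ι → Bool) :
    shadowWeight θ (liftPair σ₁ σ₂ δ) / splitCount (liftPair σ₁ σ₂ δ) =
      (2 ^ Fintype.card ι)⁻¹ * ((∏ i, θ i (σ₁ i) * θ i (σ₂ i)) *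
        (2 ^ (σ₁ * σ₂⁻¹).cycleType.card)⁻¹) := by
  have hw : (∏ i, if σ₁ i = σ₂ i then (1 : ℂ) else 2⁻¹) =
      2 ^ #{i | σ₁ i = σ₂ i} * (2 ^ Fintype.card ι)⁻¹ := by
    have : ∀ i, (if σ₁ i = σ₂ i then (1 : ℂ) else 2⁻¹) =
        (if σ₁ i = σ₂ i then 2 else 1) * 2⁻¹ := fun i => by split_ifs <;> norm_num
    rw [prod_congr rfl fun i _ => this i, prod_mul_distrib, ← prod_filter]
    simp
  have hs : shadowWeight θ (liftPair σ₁ σ₂ δ) =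
      ∏ i, (θ i (σ₁ i) * θ i (σ₂ i)) * if σ₁ i = σ₂ i then 1 else 2⁻¹ := rfl
  rw [splitCount_liftPair, hs, prod_mul_distrib, hw]
  push_cast
  field_simp

end Splitting

theorem sum_cperm_Mcover {n : ℕ} (θ : Matrix (Fin n) (Fin n) ℂ) :
    ((2 : ℂ) ^ (n ^ 2))⁻¹ * ∑ s : Fin n → Fin n → Bool, cperm (Mcover θ s) =
      (2 ^ n)⁻¹ * ∑ π, shadowWeight θ π := by
  simp only [cperm, Mcover, Matrix.of_apply]
  rw [sum_comm, mul_sum, mul_sum]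
  refine sum_congr rfl fun π _ => ?_
  simp only [prod_ite_zero, mem_univ, true_imp_iff]
  rw [← sum_filter, sum_const, nsmul_eq_mul, card_compatible_cover, Fintype.prod_prod_type]
  simp only [shadowWeight, Fintype.prod_bool, prod_mul_distrib, Fintype.card_fin]
  field_simp

end DoubleCover

/-- The squared degree-2 Bethe permanent: average of the partition sums of
all double covers (LHS) equals the permutation-pair sum with cycle-count
weights (RHS). -/
theorem degree_two_Bethe_permanent_squared (n : ℕ) (hn : 1 ≤ n)
    (θ : Matrix (Fin n) (Fin n) ℂ) :
    ((2 : ℂ) ^ (n ^ 2))⁻¹ * ∑ s : Fin n → Fin n → Bool, cperm (Mcover θ s)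
    = ∑ σ₁ : Equiv.Perm (Fin n), ∑ σ₂ : Equiv.Perm (Fin n),
        (∏ i : Fin n, θ i (σ₁ i) * θ i (σ₂ i)) *
          ((2 : ℂ) ^ ((σ₁ * σ₂⁻¹).cycleType.card))⁻¹ := by
  classical
  rw [DoubleCover.sum_cperm_Mcover, DoubleCover.sum_eq_sum_isSplit _
    (DoubleCover.shadowWeight_mul_sheetSwap θ), DoubleCover.sum_isSplit]
  simp only [DoubleCover.shadowWeight_liftPair_div]
  simp
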